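/- arXiv:0804.2109 — 3 statements merged into one kernel-verified Lean document; each statement's English description precedes it below -/
import Mathlib

section
/- Let 𝒜₁ and 𝒜₂ be boolean independent subalgebras of 𝒜 with respect to φ, X ∈ 𝒜₁, Y ∈ 𝒜₂, and a₁, …, aₙ ∈ 𝒜₁ ∨ 𝒜₂ (n ≥ 0). Then for every 0 ≤ k ≤ n the boolean cumulant with the product XY as one entry factorizes: b^{n+1}(a₁, …, a_k, XY, a_{k+1}, …, aₙ) = b^{k+1}(a₁, …, a_k, X) · b^{n−k+1}(Y, a_{k+1}, …, aₙ). -/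
/-- `b` is the family of boolean cumulants of the unital linear functional `φ`:
for a nonempty list `a₁, …, aₙ` of elements of `A`,
`φ (a₁ ⋯ aₙ) = ∑_{k=1}^{n} b(a₁,…,a_k) ⬝ φ (a_{k+1} ⋯ aₙ)`,
the empty product having `φ`-value `φ 1 = 1`. -/
def IsBooleanCumulant {A C : Type*} [Ring A] [Algebra ℂ A] [Ring C] [Algebra ℂ C]
    (φ : A →ₗ[ℂ] C) (b : List A → C) : Prop :=
  ∀ l : List A, l ≠ [] →
    φ l.prod = ∑ k ∈ Finset.range l.length,
      b (l.take (k + 1)) * φ ((l.drop (k + 1)).prod)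

/-- Two (not necessarily unital) subalgebras `A1, A2` of `A` are boolean independent
with respect to `φ` if for every nonempty alternating word (consecutive letters lying
in different subalgebras among `A1`, `A2`), `φ` of the product is the ordered product
of the individual `φ`-values. -/
def BooleanIndep {A C : Type*} [Ring A] [Algebra ℂ A] [Ring C] [Algebra ℂ C]
    (φ : A →ₗ[ℂ] C) (A1 A2 : NonUnitalSubalgebra ℂ A) : Prop :=
  ∀ l : List A, l ≠ [] →
    (∀ x ∈ l, x ∈ A1 ∨ x ∈ A2) →
    l.Chain' (fun x y => (x ∈ A1 ∧ y ∈ A2) ∨ (x ∈ A2 ∧ y ∈ A1)) →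
    φ l.prod = (l.map φ).prod

/-- Two letters lie in different subalgebras among `A1` and `A2`. -/
def Alternates {A : Type*} [Ring A] [Algebra ℂ A] (A1 A2 : NonUnitalSubalgebra ℂ A)
    (x y : A) : Prop :=
  (x ∈ A1 ∧ y ∈ A2) ∨ (x ∈ A2 ∧ y ∈ A1)

theorem alternates_swap {A : Type*} [Ring A] [Algebra ℂ A]
    (A1 A2 : NonUnitalSubalgebra ℂ A) : Alternates A1 A2 = Alternates A2 A1 := by
  funext x y
  exact propext or_comm

theorem exists_alternating_head {A : Type*} [Ring A] [Algebra ℂ A] (l : List A)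
    (A1 A2 : NonUnitalSubalgebra ℂ A) (hl : ∀ a ∈ l, a ∈ A1 ∨ a ∈ A2) (y : A) (hy : y ∈ A2) :
    ∃ w : List A, w.prod = y * l.prod ∧ (∀ x ∈ w, x ∈ A1 ∨ x ∈ A2) ∧
      (∀ x ∈ w.head?, x ∈ A2) ∧ w.IsChain (Alternates A1 A2) := by
  induction l generalizing A1 A2 y with
  | nil => exact ⟨[y], by simp, by simp [hy], by simp [hy], by simp⟩
  | cons a t ih =>
    have ht : ∀ b ∈ t, b ∈ A1 ∨ b ∈ A2 := fun b hb => hl b (by simp [hb])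
    by_cases ha : a ∈ A2
    · obtain ⟨w, hw, h⟩ := ih A1 A2 ht (y * a) (A2.mul_mem hy ha)
      exact ⟨w, by simp [hw, mul_assoc], h⟩
    · have ha1 : a ∈ A1 := (hl a (by simp)).resolve_right ha
      obtain ⟨w, hw, hm, hh, hc⟩ := ih A2 A1 (fun b hb => (ht b hb).symm) a ha1
      refine ⟨y :: w, by simp [hw], ?_, by simp [hy], ?_⟩
      · intro x hx
        rcases List.mem_cons.1 hx with rfl | hx
        · exact Or.inr hy
        · exact (hm x hx).symm
      · rw [alternates_swap, List.isChain_cons]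
        exact ⟨fun z hz => Or.inl ⟨hy, hh z hz⟩, hc⟩

theorem exists_alternating_getLast {A : Type*} [Ring A] [Algebra ℂ A] (l : List A)
    (A1 A2 : NonUnitalSubalgebra ℂ A) (hl : ∀ a ∈ l, a ∈ A1 ∨ a ∈ A2) (x : A) (hx : x ∈ A1) :
    ∃ w : List A, w.prod = l.prod * x ∧ (∀ y ∈ w, y ∈ A1 ∨ y ∈ A2) ∧
      (∀ y ∈ w.getLast?, y ∈ A1) ∧ w.IsChain (Alternates A1 A2) := by
  induction l using List.reverseRecOn generalizing A1 A2 x with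
  | nil => exact ⟨[x], by simp, by simp [hx], by simp [hx], by simp⟩
  | append_singleton t a ih =>
    have ht : ∀ b ∈ t, b ∈ A1 ∨ b ∈ A2 := fun b hb => hl b (by simp [hb])
    by_cases ha : a ∈ A1
    · obtain ⟨w, hw, h⟩ := ih A1 A2 ht (a * x) (A1.mul_mem ha hx)
      exact ⟨w, by simp [hw, mul_assoc], h⟩
    · have ha2 : a ∈ A2 := (hl a (by simp)).resolve_left ha
      obtain ⟨w, hw, hm, hh, hc⟩ := ih A2 A1 (fun b hb => (ht b hb).symm) a ha2
      refine ⟨w ++ [x], by simp [hw], ?_, by simp [hx], ?_⟩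
      · intro y hy
        rcases List.mem_append.1 hy with hy | hy
        · exact (hm y hy).symm
        · rw [List.mem_singleton.1 hy]
          exact Or.inl hx
      · rw [alternates_swap, List.isChain_append]
        refine ⟨hc, by simp, fun z hz y hy => ?_⟩
        obtain rfl : x = y := by simpa using hy
        exact Or.inl ⟨hh z hz, hx⟩

section

variable {A C : Type*} [Ring A] [Algebra ℂ A] [Ring C] [Algebra ℂ C] {φ : A →ₗ[ℂ] C}
  {A1 A2 : NonUnitalSubalgebra ℂ A}

theorem BooleanIndep.map_list_prod_of_isChain (hindep : BooleanIndep φ A1 A2) (hφ : φ 1 = 1)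
    {l : List A} (hl : ∀ x ∈ l, x ∈ A1 ∨ x ∈ A2) (hc : l.IsChain (Alternates A1 A2)) :
    φ l.prod = (l.map φ).prod := by
  rcases eq_or_ne l [] with rfl | hne
  · simpa using hφ
  · exact hindep l hne hl hc

theorem BooleanIndep.map_list_prod_mul_mul (hindep : BooleanIndep φ A1 A2) (hφ : φ 1 = 1)
    {l m : List A} (hl : ∀ a ∈ l, a ∈ A1 ∨ a ∈ A2) (hm : ∀ a ∈ m, a ∈ A1 ∨ a ∈ A2)
    {x y : A} (hx : x ∈ A1) (hy : y ∈ A2) :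
    φ ((l.prod * x) * (y * m.prod)) = φ (l.prod * x) * φ (y * m.prod) := by
  obtain ⟨w, hw, hwm, hwl, hwc⟩ := exists_alternating_getLast l A1 A2 hl x hx
  obtain ⟨z, hz, hzm, hzh, hzc⟩ := exists_alternating_head m A1 A2 hm y hy
  rw [← hw, ← hz, ← List.prod_append, hindep.map_list_prod_of_isChain hφ hwm hwc,
    hindep.map_list_prod_of_isChain hφ hzm hzc, hindep.map_list_prod_of_isChain hφ]
  · simp
  · intro a ha
    exact (List.mem_append.1 ha).elim (hwm a) (hzm a)
  · exact List.isChain_append.2 ⟨hwc, hzc, fun a ha c hc => Or.inl ⟨hwl a ha, hzh c hc⟩⟩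

theorem BooleanIndep.map_mul_mul (hindep : BooleanIndep φ A1 A2) (hφ : φ 1 = 1)
    {p q x y : A} (hp : p ∈ Algebra.adjoin ℂ (A1 ∪ A2 : Set A))
    (hq : q ∈ Algebra.adjoin ℂ (A1 ∪ A2 : Set A)) (hx : x ∈ A1) (hy : y ∈ A2) :
    φ ((p * x) * (y * q)) = φ (p * x) * φ (y * q) := by
  rw [← Subalgebra.mem_toSubmodule, Algebra.adjoin_eq_span] at hp hq
  induction hp using Submodule.span_induction with
  | zero => simp
  | add p₁ p₂ _ _ h₁ h₂ => simp only [add_mul, map_add, h₁, h₂]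
  | smul c p _ h => simp only [smul_mul_assoc, map_smul, h]
  | mem p hp =>
    induction hq using Submodule.span_induction with
    | zero => simp
    | add q₁ q₂ _ _ h₁ h₂ => simp only [mul_add, map_add, h₁, h₂]
    | smul c q _ h => simp only [mul_smul_comm, map_smul, h]
    | mem q hq =>
      obtain ⟨l, hl, rfl⟩ := Submonoid.exists_list_of_mem_closure hp
      obtain ⟨m, hm, rfl⟩ := Submonoid.exists_list_of_mem_closure hq
      exact hindep.map_list_prod_mul_mul hφ hl hm hx hy

theorem list_prod_mem_adjoin_union {l : List A} (hl : ∀ a ∈ l, a ∈ A1 ⊔ A2) :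
    l.prod ∈ Algebra.adjoin ℂ (A1 ∪ A2 : Set A) := by
  have hle : A1 ⊔ A2 ≤ (Algebra.adjoin ℂ (A1 ∪ A2 : Set A)).toNonUnitalSubalgebra :=
    sup_le (fun a ha => Algebra.subset_adjoin (Or.inl ha))
      (fun a ha => Algebra.subset_adjoin (Or.inr ha))
  exact Subalgebra.list_prod_mem _ fun a ha => hle (hl a ha)

/-- The defining recursion of the boolean cumulants, split at an entry `x`. -/
theorem IsBooleanCumulant.map_prod_append_cons {b : List A → C} (hb : IsBooleanCumulant φ b)
    (u : List A) (x : A) (v : List A) :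
    φ (u.prod * (x * v.prod)) =
      ∑ k ∈ Finset.range u.length,
        b (u.take (k + 1)) * φ ((u.drop (k + 1)).prod * (x * v.prod)) +
      ∑ k ∈ Finset.range (v.length + 1), b (u ++ x :: v.take k) * φ (v.drop k).prod := by
  have h := hb (u ++ x :: v) (by simp)
  rw [List.length_append, List.length_cons, Finset.sum_range_add] at h
  rw [List.prod_append, List.prod_cons] at h
  rw [h]
  congr 1
  · refine Finset.sum_congr rfl fun k hk => ?_
    have hk' : k + 1 ≤ u.length := Finset.mem_range.1 hk
    rw [List.take_append_of_le_length hk', List.drop_append_of_le_length hk', List.prod_append,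
      List.prod_cons]
  · refine Finset.sum_congr rfl fun k _ => ?_
    rw [add_assoc, List.take_length_add_append, List.drop_length_add_append, List.take_succ_cons,
      List.drop_succ_cons]

end

/-- Proposition 3.5 (i): the boolean cumulant with the product `XY` as one entry
factorizes:
`b^{n+1}(a₁,…,a_k, XY, a_{k+1},…,aₙ) = b^{k+1}(a₁,…,a_k, X) ⬝ b^{n-k+1}(Y, a_{k+1},…,aₙ)`.
Here `u = (a₁,…,a_k)` and `v = (a_{k+1},…,aₙ)` are arbitrary (possibly empty) lists
of elements of the subalgebra generated by `A1` and `A2`. -/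
theorem boolean_cumulant_product_entry_factorizes
    {A C : Type*} [Ring A] [Algebra ℂ A] [Ring C] [Algebra ℂ C]
    (φ : A →ₗ[ℂ] C) (hφ : φ 1 = 1)
    (A1 A2 : NonUnitalSubalgebra ℂ A) (hindep : BooleanIndep φ A1 A2)
    (b : List A → C) (hb : IsBooleanCumulant φ b)
    (X Y : A) (hX : X ∈ A1) (hY : Y ∈ A2)
    (u v : List A) (hu : ∀ a ∈ u, a ∈ A1 ⊔ A2) (hv : ∀ a ∈ v, a ∈ A1 ⊔ A2) :
    b (u ++ (X * Y) :: v) = b (u ++ [X]) * b (Y :: v) := by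
  have hfac : ∀ l : List A, (∀ a ∈ l, a ∈ A1 ⊔ A2) → ∀ m : List A, (∀ a ∈ m, a ∈ A1 ⊔ A2) →
      φ (l.prod * (X * Y * m.prod)) = φ (l.prod * X) * φ (Y * m.prod) := fun l hl m hm => by
    rw [← hindep.map_mul_mul hφ (list_prod_mem_adjoin_union hl) (list_prod_mem_adjoin_union hm)
      hX hY]
    simp only [mul_assoc]
  induction hn : v.length using Nat.strong_induction_on generalizing v with
  | _ n ih =>
    subst hn
    have hXY := hb.map_prod_append_cons u (X * Y) v
    have hX' := hb.map_prod_append_cons u X []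
    have hY' := hb.map_prod_append_cons [] Y v
    simp only [List.prod_nil, mul_one, one_mul, List.length_nil, zero_add, Finset.range_one,
      Finset.sum_singleton, List.take_nil, List.drop_nil, hφ, Finset.range_zero,
      Finset.sum_empty, List.nil_append] at hX' hY'
    have hdrop : ∀ k ∈ Finset.range u.length,
        b (u.take (k + 1)) * φ ((u.drop (k + 1)).prod * (X * Y * v.prod)) =
          b (u.take (k + 1)) * φ ((u.drop (k + 1)).prod * X) * φ (Y * v.prod) := fun k _ => by
      rw [hfac _ (fun a ha => hu a (List.mem_of_mem_drop ha)) v hv, mul_assoc]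
    rw [hfac u hu v hv, hX', Finset.sum_congr rfl hdrop, ← Finset.sum_mul, add_mul,
      add_right_inj, hY', Finset.mul_sum, Finset.sum_range_succ, Finset.sum_range_succ] at hXY
    have hlt : ∀ k ∈ Finset.range v.length,
        b (u ++ X * Y :: v.take k) * φ (v.drop k).prod =
          b (u ++ [X]) * (b (Y :: v.take k) * φ (v.drop k).prod) := fun k hk => by
      have hk' := Finset.mem_range.1 hk
      rw [ih _ (by simpa using hk') (v.take k) (fun a ha => hv a (List.mem_of_mem_take ha)) rfl,
        mul_assoc]
    rw [Finset.sum_congr rfl hlt, add_right_inj] at hXY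
    simpa [hφ] using hXY.symm
end

section
/- Let 𝒜₁ and 𝒜₂ be boolean independent subalgebras of 𝒜 with respect to φ, X ∈ 𝒜₁, Y ∈ 𝒜₂, and a₁, …, aₙ ∈ 𝒜₁ ∨ 𝒜₂ (n ≥ 0). Then for every 0 ≤ k ≤ n the boolean cumulant with consecutive entries XY and X vanishes: b^{n+2}(a₁, …, a_k, XY, X, a_{k+1}, …, aₙ) = 0. -/
open List in
/-- If `φ` splits multiplicatively between every suffix of `l₁` and every prefix of `l₂`, then
the boolean cumulant of the concatenation `l₁ ++ l₂` vanishes. -/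
theorem IsBooleanCumulant.append_eq_zero {A C : Type*} [Ring A] [Algebra ℂ A] [Ring C]
    [Algebra ℂ C] {φ : A →ₗ[ℂ] C} (hφ : φ 1 = 1) {b : List A → C} (hb : IsBooleanCumulant φ b)
    {l₁ l₂ : List A} (h₁ : l₁ ≠ []) (h₂ : l₂ ≠ [])
    (h : ∀ s t, s <:+ l₁ → t <+: l₂ → φ (s.prod * t.prod) = φ s.prod * φ t.prod) :
    b (l₁ ++ l₂) = 0 := by
  induction hn : l₂.length using Nat.strong_induction_on generalizing l₂ with
  | _ n ih =>
    obtain ⟨m, rfl⟩ : ∃ m, n = m + 1 :=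
      ⟨n - 1, by have := length_pos_of_ne_nil h₂; omega⟩
    have key := hb (l₁ ++ l₂) (by simp [h₁])
    have head : ∑ k ∈ Finset.range l₁.length, b ((l₁ ++ l₂).take (k + 1)) *
        φ (((l₁ ++ l₂).drop (k + 1)).prod) = φ l₁.prod * φ l₂.prod := by
      rw [hb l₁ h₁, Finset.sum_mul]
      refine Finset.sum_congr rfl fun k hk => ?_
      have hk' : k + 1 ≤ l₁.length := Finset.mem_range.mp hk
      rw [take_append_of_le_length hk', drop_append_of_le_length hk', prod_append,
        h _ _ (drop_suffix _ _) prefix_rfl, mul_assoc]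
    have tail : ∑ k ∈ Finset.range m, b ((l₁ ++ l₂).take (l₁.length + k + 1)) *
        φ (((l₁ ++ l₂).drop (l₁.length + k + 1)).prod) = 0 := by
      refine Finset.sum_eq_zero fun k hk => ?_
      have hk' : k < m := Finset.mem_range.mp hk
      rw [add_assoc, take_length_add_append, ih (k + 1) (by omega), zero_mul]
      · rw [ne_eq, ← length_eq_zero_iff, length_take]
        omega
      · exact fun s t hs ht => h s t hs (ht.trans (take_prefix _ _))
      · rw [length_take]
        omega
    rw [prod_append, h _ _ suffix_rfl prefix_rfl, length_append, hn, Finset.sum_range_add, head,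
      Finset.sum_range_succ, tail, zero_add, left_eq_add] at key
    have hlen : (l₁ ++ l₂).length = l₁.length + m + 1 := by rw [length_append, hn, add_assoc]
    rwa [← hlen, take_length, drop_length, prod_nil, hφ, mul_one] at key

/-- `AlternatingWord S i j l`: the letters of the nonempty word `l` lie alternately in the members
of the family `S`, the first one in `S i` and the last one in `S j`. -/
inductive AlternatingWord {A : Type*} (S : Bool → Set A) : Bool → Bool → List A → Prop
  | singleton {i : Bool} {x : A} (hx : x ∈ S i) : AlternatingWord S i i [x]
  | cons {i j : Bool} {x : A} {l : List A} (hx : x ∈ S i) (hl : AlternatingWord S (!i) j l) :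
      AlternatingWord S i j (x :: l)

namespace AlternatingWord

section Set

variable {A : Type*} {S : Bool → Set A} {i j k : Bool} {l l' : List A}

theorem ne_nil (h : AlternatingWord S i j l) : l ≠ [] := by
  cases h <;> simp

theorem append (h : AlternatingWord S i j l) (h' : AlternatingWord S (!j) k l') :
    AlternatingWord S i k (l ++ l') := by
  induction h with
  | singleton hx => exact cons hx h'
  | cons hx _ ih => exact cons hx (ih h')

theorem exists_mem (h : AlternatingWord S i j l) : ∀ x ∈ l, ∃ k, x ∈ S k := by
  induction h with
  | singleton hx => exact List.forall_mem_singleton.mpr ⟨_, hx⟩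
  | cons hx _ ih => exact List.forall_mem_cons.mpr ⟨⟨_, hx⟩, ih⟩

theorem isChain (h : AlternatingWord S i j l) :
    l.IsChain fun x y => ∃ k, x ∈ S k ∧ y ∈ S (!k) := by
  induction h with
  | singleton hx => simp
  | cons hx hl ih =>
    cases hl with
    | singleton hy => exact List.isChain_pair.mpr ⟨_, hx, hy⟩
    | cons hy hl => exact List.isChain_cons_cons.mpr ⟨⟨_, hx, hy⟩, ih⟩

end Set

variable {A : Type*} [Ring A] [Algebra ℂ A] (S : Bool → NonUnitalSubalgebra ℂ A)

/-- The span of the products of alternating words whose first letter lies in `S i`. -/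
def startSpan (i : Bool) : Submodule ℂ A :=
  Submodule.span ℂ {a | ∃ j l, AlternatingWord (fun k => (S k : Set A)) i j l ∧ l.prod = a}

/-- The span of the products of alternating words whose last letter lies in `S j`. -/
def endSpan (j : Bool) : Submodule ℂ A :=
  Submodule.span ℂ {a | ∃ i l, AlternatingWord (fun k => (S k : Set A)) i j l ∧ l.prod = a}

variable {S} {i j : Bool} {l : List A}

theorem prod_mem_startSpan (h : AlternatingWord (fun k => (S k : Set A)) i j l) :
    l.prod ∈ startSpan S i :=
  Submodule.subset_span ⟨j, l, h, rfl⟩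

theorem prod_mem_endSpan (h : AlternatingWord (fun k => (S k : Set A)) i j l) :
    l.prod ∈ endSpan S j :=
  Submodule.subset_span ⟨i, l, h, rfl⟩

theorem mem_startSpan {x : A} (hx : x ∈ S i) : x ∈ startSpan S i := by
  simpa using prod_mem_startSpan (S := S) (singleton hx)

theorem mem_endSpan {x : A} (hx : x ∈ S i) : x ∈ endSpan S i := by
  simpa using prod_mem_endSpan (S := S) (singleton hx)

theorem mul_mem_startSpan {x a : A} (hx : x ∈ S i) (ha : a ∈ startSpan S (!i)) :
    x * a ∈ startSpan S i := by
  induction ha using Submodule.span_induction with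
  | mem a ha =>
    obtain ⟨j, l, hl, rfl⟩ := ha
    simpa using prod_mem_startSpan (S := S) (cons hx hl)
  | zero => simp
  | add a b _ _ ha hb => simpa [mul_add] using add_mem ha hb
  | smul c a _ ha => simpa using Submodule.smul_mem _ c ha

theorem mul_prod_mem_endSpan {a : A} (ha : a ∈ endSpan S i)
    (h : AlternatingWord (fun k => (S k : Set A)) (!i) j l) : a * l.prod ∈ endSpan S j := by
  induction ha using Submodule.span_induction with
  | mem a ha =>
    obtain ⟨k, l', hl', rfl⟩ := ha
    simpa using prod_mem_endSpan (S := S) (hl'.append h)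
  | zero => simp
  | add a b _ _ ha hb => simpa [add_mul] using add_mem ha hb
  | smul c a _ ha => simpa using Submodule.smul_mem _ c ha

variable (S)

/-- The elements `q` such that `S i * q ⊆ startSpan S i` for every `i`. -/
def rightMultipliers : Subalgebra ℂ A where
  carrier := {q | ∀ i, ∀ x ∈ S i, x * q ∈ startSpan S i}
  mul_mem' {p q} hp hq i x hx := by
    have hword : ∀ {i j l}, AlternatingWord (fun k => (S k : Set A)) i j l →
        l.prod * q ∈ startSpan S i := by
      intro i j l hl
      induction hl with
      | singleton hx => simpa using hq _ _ hx
      | cons hx _ ih => simpa [mul_assoc] using mul_mem_startSpan hx ih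
    have hspan : startSpan S i ≤ (startSpan S i).comap (LinearMap.mulRight ℂ q) :=
      Submodule.span_le.mpr <| by
        rintro _ ⟨j, l, hl, rfl⟩
        exact hword hl
    simpa [mul_assoc] using hspan (hp i x hx)
  add_mem' hp hq i x hx := by simpa [mul_add] using add_mem (hp i x hx) (hq i x hx)
  algebraMap_mem' c i x hx := by
    rw [← Algebra.commutes, ← Algebra.smul_def]
    exact Submodule.smul_mem _ c (mem_startSpan hx)

/-- The elements `p` such that `p * S j ⊆ endSpan S j` for every `j`. -/
def leftMultipliers : Subalgebra ℂ A where
  carrier := {p | ∀ j, ∀ y ∈ S j, p * y ∈ endSpan S j}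
  mul_mem' {p q} hp hq j y hy := by
    have hspan : endSpan S j ≤ (endSpan S j).comap (LinearMap.mulLeft ℂ p) :=
      Submodule.span_le.mpr <| by
        rintro _ ⟨i, l, hl, rfl⟩
        cases hl with
        | singleton hx => simpa using hp _ _ hx
        | cons hx hl => simpa [mul_assoc] using mul_prod_mem_endSpan (hp _ _ hx) hl
    simpa [mul_assoc] using hspan (hq j y hy)
  add_mem' hp hq j y hy := by simpa [add_mul] using add_mem (hp j y hy) (hq j y hy)
  algebraMap_mem' c j y hy := by
    rw [← Algebra.smul_def]
    exact Submodule.smul_mem _ c (mem_endSpan hy)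

theorem le_rightMultipliers (k : Bool) :
    S k ≤ (rightMultipliers S).toNonUnitalSubalgebra := by
  intro y hy i x hx
  obtain rfl | rfl := Bool.eq_or_eq_not k i
  · exact mem_startSpan (mul_mem hx hy)
  · exact mul_mem_startSpan hx (mem_startSpan hy)

theorem le_leftMultipliers (k : Bool) :
    S k ≤ (leftMultipliers S).toNonUnitalSubalgebra := by
  intro x hx j y hy
  obtain rfl | rfl := Bool.eq_or_eq_not j k
  · exact mem_endSpan (mul_mem hx hy)
  · simpa using mul_prod_mem_endSpan (S := S) (mem_endSpan hx) (singleton hy)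

end AlternatingWord

open AlternatingWord

namespace BooleanIndep

variable {A C : Type*} [Ring A] [Algebra ℂ A] [Ring C] [Algebra ℂ C] {φ : A →ₗ[ℂ] C}
  {S : Bool → NonUnitalSubalgebra ℂ A}

theorem map_prod (h : BooleanIndep φ (S false) (S true)) {i j : Bool} {l : List A}
    (hl : AlternatingWord (fun k => (S k : Set A)) i j l) : φ l.prod = (l.map φ).prod :=
  h l hl.ne_nil (fun x hx => by simpa using hl.exists_mem x hx)
    (hl.isChain.imp fun x y hxy => by simpa using hxy)

theorem map_mul (h : BooleanIndep φ (S false) (S true)) {i : Bool} {a c : A}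
    (ha : a ∈ endSpan S i) (hc : c ∈ startSpan S (!i)) : φ (a * c) = φ a * φ c := by
  induction ha, hc using Submodule.span_induction₂ with
  | mem_mem a c ha hc =>
    obtain ⟨_, l, hl, rfl⟩ := ha
    obtain ⟨_, l', hl', rfl⟩ := hc
    rw [← List.prod_append, h.map_prod (hl.append hl'), h.map_prod hl, h.map_prod hl',
      List.map_append, List.prod_append]
  | zero_left => simp
  | zero_right => simp
  | add_left _ _ _ _ _ _ h₁ h₂ => simp [add_mul, h₁, h₂]
  | add_right _ _ _ _ _ _ h₁ h₂ => simp [mul_add, h₁, h₂]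
  | smul_left _ _ _ _ _ h => simp [h]
  | smul_right _ _ _ _ _ h => simp [h]

end BooleanIndep

/-- Proposition 3.5 (iv): the boolean cumulant with consecutive entries `XY` and `X`
vanishes: `b^{n+2}(a₁,…,a_k, XY, X, a_{k+1},…,aₙ) = 0`. -/
theorem boolean_cumulant_XY_X_vanish
    {A C : Type*} [Ring A] [Algebra ℂ A] [Ring C] [Algebra ℂ C]
    (φ : A →ₗ[ℂ] C) (hφ : φ 1 = 1)
    (A1 A2 : NonUnitalSubalgebra ℂ A) (hindep : BooleanIndep φ A1 A2)
    (b : List A → C) (hb : IsBooleanCumulant φ b)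
    (X Y : A) (hX : X ∈ A1) (hY : Y ∈ A2)
    (u v : List A) (hu : ∀ a ∈ u, a ∈ A1 ⊔ A2) (hv : ∀ a ∈ v, a ∈ A1 ⊔ A2) :
    b (u ++ (X * Y) :: X :: v) = 0 := by
  let S : Bool → NonUnitalSubalgebra ℂ A := fun k => bif k then A2 else A1
  have hS : BooleanIndep φ (S false) (S true) := hindep
  have hR : A1 ⊔ A2 ≤ (rightMultipliers S).toNonUnitalSubalgebra :=
    sup_le (le_rightMultipliers S false) (le_rightMultipliers S true)
  have hL : A1 ⊔ A2 ≤ (leftMultipliers S).toNonUnitalSubalgebra :=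
    sup_le (le_leftMultipliers S false) (le_leftMultipliers S true)
  have hstart : ∀ t, t <+: v → X * t.prod ∈ startSpan S false := fun t ht =>
    list_prod_mem (S := rightMultipliers S) (fun a ha => hR (hv a (ht.subset ha))) false X hX
  have hend : ∀ s, s <:+ u → s.prod * (X * Y) ∈ endSpan S true := fun s hs => by
    rw [← mul_assoc]
    have hmem : s.prod * X ∈ leftMultipliers S :=
      mul_mem (list_prod_mem fun a ha => hL (hu a (hs.subset ha))) (le_leftMultipliers S false hX)
    exact hmem true Y hY
  have hsplit := hb.append_eq_zero hφ (l₁ := u ++ [X * Y]) (l₂ := X :: v) (by simp) (by simp) <| by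
    intro s t hs ht
    obtain rfl | ⟨s, rfl, hsu⟩ := List.suffix_concat_iff.mp hs
    · simp [hφ]
    obtain rfl | ⟨t, rfl, htv⟩ := List.prefix_cons_iff.mp ht
    · simp [hφ]
    simpa using hS.map_mul (hend s hsu) (hstart t htv)
  simpa using hsplit
end

section
/- For all X ∈ 𝔄 and n ≥ 2, the operator-valued boolean cumulants of 1+X are given by a sum over interval partitions: b̃^n_{1+X}(f₁, …, f_{n−1}) = Σ_{γ ∈ 𝓘(n−1)} b̃^{|γ|+1}_X(π_γ(f₁, …, f_{n−1})) for all f₁, …, f_{n−1} ∈ 𝔅. -/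
/-- The interleaved word `X₁ f₁ X₂ f₂ ⋯ f_{n-1} Xₙ` built from a list
`Xs = [X₁, …, Xₙ]` (lower arguments) and a list `fs = [f₁, …, f_{n-1}]`
(upper arguments). -/
def interWord {A : Type*} [Monoid A] : List A → List A → A
  | [], _ => 1
  | [x], _ => x
  | x :: xs, [] => x * interWord xs []
  | x :: xs, f :: fs => x * f * interWord xs fs

/-- `bt` is the family of operator-valued boolean cumulants of the conditional
expectation `Φ : 𝔄 → 𝔅`:  `bt Xs fs` stands for `b̃^n_{X₁,…,Xₙ}(f₁,…,f_{n-1})`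
(where `Xs = [X₁,…,Xₙ]`, `fs = [f₁,…,f_{n-1}]`), and for all lower arguments in `𝔄`
and upper arguments in `𝔅`,
`Φ(X₁f₁X₂⋯f_{n-1}Xₙ) = ∑_{k=1}^{n} b̃^k_{X₁,…,X_k}(f₁,…,f_{k-1}) ⬝ f_k ⬝
Φ(X_{k+1}f_{k+1}⋯f_{n-1}Xₙ)`, the `k = n` summand being
`b̃^n_{X₁,…,Xₙ}(f₁,…,f_{n-1})`. -/
def IsOpBooleanCumulant {A : Type*} [Ring A] [Algebra ℂ A]
    (B : Subalgebra ℂ A) (Φ : A →ₗ[ℂ] A) (bt : List A → List A → A) : Prop :=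
  ∀ (Xs fs : List A), Xs.length = fs.length + 1 → (∀ f ∈ fs, f ∈ B) →
    Φ (interWord Xs fs) =
      (∑ k ∈ Finset.range fs.length,
        bt (Xs.take (k + 1)) (fs.take k) * fs.getD k 1 *
          Φ (interWord (Xs.drop (k + 1)) (fs.drop (k + 1)))) + bt Xs fs

/-- Two subalgebras `A1, A2` of `𝔄` are boolean independent over `𝔅` (with respect
to the conditional expectation `Φ`) if for every nonempty alternating word
(consecutive letters lying in different subalgebras among `A1`, `A2`), `Φ` of the
product is the ordered product of the individual `Φ`-values. -/
def BooleanIndepOver {A : Type*} [Ring A] [Algebra ℂ A]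
    (Φ : A →ₗ[ℂ] A) (A1 A2 : NonUnitalSubalgebra ℂ A) : Prop :=
  ∀ l : List A, l ≠ [] →
    (∀ x ∈ l, x ∈ A1 ∨ x ∈ A2) →
    l.Chain' (fun x y => (x ∈ A1 ∧ y ∈ A2) ∨ (x ∈ A2 ∧ y ∈ A1)) →
    Φ l.prod = (l.map Φ).prod

theorem interWord_cons_cons {A : Type*} [Monoid A] (x f : A) (xs fs : List A) (h : xs ≠ []) :
    interWord (x :: xs) (f :: fs) = x * f * interWord xs fs := by
  cases xs with
  | nil => exact absurd rfl h
  | cons y ys => rfl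

theorem interWord_add {A : Type*} [Ring A] (x y : A) (s p fs : List A) :
    interWord (p ++ (x + y) :: s) fs =
      interWord (p ++ x :: s) fs + interWord (p ++ y :: s) fs := by
  induction p generalizing fs with
  | nil =>
    cases s with
    | nil => cases fs <;> rfl
    | cons z zs => cases fs <;> simp [interWord, add_mul]
  | cons a p ih =>
    cases fs with
    | nil =>
      have h (w : A) : interWord (a :: p ++ w :: s) [] = a * interWord (p ++ w :: s) [] := by
        cases p <;> rfl
      rw [h, h, h, ih, mul_add]
    | cons f fs =>
      simp only [List.cons_append]
      rw [interWord_cons_cons _ _ _ _ (by simp), interWord_cons_cons _ _ _ _ (by simp),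
        interWord_cons_cons _ _ _ _ (by simp), ih, mul_add]

theorem interWord_append_one {A : Type*} [Monoid A] (f : A) (p u : List A)
    (h : p.length = u.length + 1) :
    interWord (p ++ [1]) (u ++ [f]) = interWord p u * f := by
  induction u generalizing p with
  | nil =>
    obtain ⟨x, rfl⟩ := List.length_eq_one_iff.1 h
    simp [interWord]
  | cons g u ih =>
    obtain _ | ⟨x, p⟩ := p
    · simp at h
    · have hp : p.length = u.length + 1 := by simpa using h
      have hp' : p ≠ [] := by rintro rfl; simp at hp
      simp only [List.cons_append]
      rw [interWord_cons_cons _ _ _ _ (by simp), interWord_cons_cons _ _ _ _ hp', ih p hp]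
      simp only [mul_assoc]

theorem interWord_insert_one {A : Type*} [Monoid A] (f g : A) (s v p u : List A)
    (hp : p.length = u.length + 1) (hs : s ≠ []) :
    interWord (p ++ 1 :: s) (u ++ f :: g :: v) = interWord (p ++ s) (u ++ f * g :: v) := by
  induction u generalizing p with
  | nil =>
    obtain ⟨x, rfl⟩ := List.length_eq_one_iff.1 hp
    simp only [List.cons_append, List.nil_append]
    rw [interWord_cons_cons _ _ _ _ (by simp), interWord_cons_cons _ _ _ _ hs,
      interWord_cons_cons _ _ _ _ hs]
    simp [mul_assoc]
  | cons h u ih =>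
    obtain _ | ⟨x, p⟩ := p
    · simp at hp
    · simp only [List.cons_append]
      rw [interWord_cons_cons _ _ _ _ (by simp), interWord_cons_cons _ _ _ _ (by simp [hs]),
        ih p (by simpa using hp)]

namespace IsOpBooleanCumulant

variable {A : Type*} [Ring A] [Algebra ℂ A] {B : Subalgebra ℂ A} {Φ : A →ₗ[ℂ] A}
  {bt : List A → List A → A}

theorem add_entry (hbt : IsOpBooleanCumulant B Φ bt) (x y : A) (p s fs : List A)
    (hl : p.length + s.length = fs.length) (hfs : ∀ f ∈ fs, f ∈ B) :
    bt (p ++ (x + y) :: s) fs = bt (p ++ x :: s) fs + bt (p ++ y :: s) fs := by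
  induction hn : fs.length using Nat.strong_induction_on generalizing fs s with
  | _ n ih =>
    subst hn
    have h (z : A) := hbt (p ++ z :: s) fs (by simp; omega) hfs
    have key := congrArg Φ (interWord_add x y s p fs)
    rw [map_add, h, h, h] at key
    have hsum : ∀ k ∈ Finset.range fs.length,
        bt ((p ++ (x + y) :: s).take (k + 1)) (fs.take k) * fs.getD k 1 *
            Φ (interWord ((p ++ (x + y) :: s).drop (k + 1)) (fs.drop (k + 1))) =
          bt ((p ++ x :: s).take (k + 1)) (fs.take k) * fs.getD k 1 *
            Φ (interWord ((p ++ x :: s).drop (k + 1)) (fs.drop (k + 1))) +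
          bt ((p ++ y :: s).take (k + 1)) (fs.take k) * fs.getD k 1 *
            Φ (interWord ((p ++ y :: s).drop (k + 1)) (fs.drop (k + 1))) := by
      intro k hk
      rw [Finset.mem_range] at hk
      rcases lt_or_ge k p.length with hkp | hkp
      · have h1 (z : A) : (p ++ z :: s).take (k + 1) = p.take (k + 1) :=
          List.take_append_of_le_length hkp
        have h2 (z : A) : (p ++ z :: s).drop (k + 1) = p.drop (k + 1) ++ z :: s :=
          List.drop_append_of_le_length hkp
        simp only [h1, h2, interWord_add, map_add, mul_add]
      · obtain ⟨j, rfl⟩ := Nat.exists_eq_add_of_le hkp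
        have h1 (z : A) : (p ++ z :: s).take (p.length + j + 1) = p ++ z :: s.take j := by
          rw [add_assoc, List.take_length_add_append, List.take_succ_cons]
        have h2 (z : A) : (p ++ z :: s).drop (p.length + j + 1) = s.drop j := by
          rw [add_assoc, List.drop_length_add_append, List.drop_succ_cons]
        simp only [h1, h2]
        rw [ih (p.length + j) hk (s.take j) (fs.take (p.length + j))
          (by simp; omega) (fun f hf => hfs f (List.mem_of_mem_take hf)) (by simp; omega)]
        simp only [add_mul]
    rw [Finset.sum_congr rfl hsum, Finset.sum_add_distrib] at key
    rw [add_add_add_comm] at key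
    exact add_left_cancel key

theorem singleton (hbt : IsOpBooleanCumulant B Φ bt) (x : A) : bt [x] [] = Φ x := by
  simpa [interWord] using (hbt [x] [] rfl (by simp)).symm

theorem one_cons (hbt : IsOpBooleanCumulant B Φ bt) (hΦid : ∀ b ∈ B, Φ b = b)
    (hΦbimod : ∀ b₁ ∈ B, ∀ b₂ ∈ B, ∀ a, Φ (b₁ * a * b₂) = b₁ * Φ a * b₂)
    (s fs : List A) (hl : s.length = fs.length) (hs : s ≠ []) (hfs : ∀ f ∈ fs, f ∈ B) :
    bt (1 :: s) fs = 0 := by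
  induction hn : fs.length using Nat.strong_induction_on generalizing fs s with
  | _ n ih =>
    subst hn
    obtain _ | ⟨f, fs⟩ := fs
    · simp_all
    have key := hbt (1 :: s) (f :: fs) (by simpa using hl) hfs
    have hsum : ∀ k ∈ Finset.range fs.length,
        bt ((1 :: s).take (k + 1 + 1)) ((f :: fs).take (k + 1)) * (f :: fs).getD (k + 1) 1 *
          Φ (interWord ((1 :: s).drop (k + 1 + 1)) ((f :: fs).drop (k + 1 + 1))) = 0 := by
      intro k hk
      rw [Finset.mem_range] at hk
      simp only [List.length_cons] at hl
      rw [List.take_succ_cons, ih (k + 1) (by simpa using hk) (s.take (k + 1))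
        ((f :: fs).take (k + 1)) (by simp; omega) (by simpa using hs)
        (fun g hg => hfs g (List.mem_of_mem_take hg)) (by simp; omega)]
      simp
    rw [List.length_cons, Finset.sum_range_succ', Finset.sum_eq_zero hsum,
      interWord_cons_cons _ _ _ _ hs] at key
    have h1 := hΦbimod f (hfs f (by simp)) 1 B.one_mem (interWord s fs)
    simp only [mul_one] at h1
    simpa [hbt.singleton, hΦid 1 B.one_mem, h1] using key

theorem append_one (hbt : IsOpBooleanCumulant B Φ bt) (hΦid : ∀ b ∈ B, Φ b = b)
    (hΦbimod : ∀ b₁ ∈ B, ∀ b₂ ∈ B, ∀ a, Φ (b₁ * a * b₂) = b₁ * Φ a * b₂)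
    (p fs : List A) (hl : p.length = fs.length) (hp : p ≠ []) (hfs : ∀ f ∈ fs, f ∈ B) :
    bt (p ++ [1]) fs = 0 := by
  obtain rfl | ⟨u, f, rfl⟩ := fs.eq_nil_or_concat'
  · simp_all
  have hl' : p.length = u.length + 1 := by simpa using hl
  have hf : f ∈ B := hfs f (by simp)
  have hmul (a : A) : Φ (a * f) = Φ a * f := by
    simpa using hΦbimod 1 B.one_mem f hf a
  have key := hbt (p ++ [1]) (u ++ [f]) (by simp [hl']) hfs
  have key' := hbt p u hl' (fun g hg => hfs g (by simp [hg]))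
  have hsum : ∀ k ∈ Finset.range u.length,
      bt ((p ++ [1]).take (k + 1)) ((u ++ [f]).take k) * (u ++ [f]).getD k 1 *
          Φ (interWord ((p ++ [1]).drop (k + 1)) ((u ++ [f]).drop (k + 1))) =
        bt (p.take (k + 1)) (u.take k) * u.getD k 1 *
          Φ (interWord (p.drop (k + 1)) (u.drop (k + 1))) * f := by
    intro k hk
    rw [Finset.mem_range] at hk
    rw [List.take_append_of_le_length (by omega), List.take_append_of_le_length (by omega),
      List.drop_append_of_le_length (by omega), List.drop_append_of_le_length (by omega),
      List.getD_append _ _ _ _ hk, interWord_append_one _ _ _ (by simp; omega), hmul]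
    simp only [mul_assoc]
  rw [interWord_append_one _ _ _ hl', hmul, key', List.length_append, List.length_singleton,
    Finset.sum_range_succ, Finset.sum_congr rfl hsum, ← Finset.sum_mul, ← hl'] at key
  rw [List.take_append_of_le_length le_rfl, List.drop_append_of_le_length le_rfl] at key
  simpa [interWord, hΦid 1 B.one_mem, add_mul] using key

theorem insert_one (hbt : IsOpBooleanCumulant B Φ bt) (hΦid : ∀ b ∈ B, Φ b = b)
    (hΦbimod : ∀ b₁ ∈ B, ∀ b₂ ∈ B, ∀ a, Φ (b₁ * a * b₂) = b₁ * Φ a * b₂)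
    (f g : A) (p u s v : List A) (hp : p.length = u.length + 1) (hs : s.length = v.length + 1)
    (hu : ∀ h ∈ u, h ∈ B) (hf : f ∈ B) (hg : g ∈ B) (hv : ∀ h ∈ v, h ∈ B) :
    bt (p ++ 1 :: s) (u ++ f :: g :: v) = bt (p ++ s) (u ++ f * g :: v) := by
  induction hn : v.length using Nat.strong_induction_on generalizing s v with
  | _ n ih =>
    subst hn
    have hs' : s ≠ [] := by rintro rfl; simp at hs
    have hfs : ∀ h ∈ u ++ f :: g :: v, h ∈ B := by
      simp only [List.mem_append, List.mem_cons]
      rintro h (h' | rfl | rfl | h')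
      exacts [hu _ h', hf, hg, hv _ h']
    have hfs' : ∀ h ∈ u ++ f * g :: v, h ∈ B := by
      simp only [List.mem_append, List.mem_cons]
      rintro h (h' | rfl | h')
      exacts [hu _ h', B.mul_mem hf hg, hv _ h']
    have key := hbt (p ++ 1 :: s) (u ++ f :: g :: v) (by simp; omega) hfs
    have key' := hbt (p ++ s) (u ++ f * g :: v) (by simp; omega) hfs'
    rw [interWord_insert_one f g s v p u hp hs', key'] at key
    have hlow : ∀ k ∈ Finset.range u.length,
        bt ((p ++ 1 :: s).take (k + 1)) ((u ++ f :: g :: v).take k) *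
            (u ++ f :: g :: v).getD k 1 *
            Φ (interWord ((p ++ 1 :: s).drop (k + 1)) ((u ++ f :: g :: v).drop (k + 1))) =
          bt ((p ++ s).take (k + 1)) ((u ++ f * g :: v).take k) * (u ++ f * g :: v).getD k 1 *
            Φ (interWord ((p ++ s).drop (k + 1)) ((u ++ f * g :: v).drop (k + 1))) := by
      intro k hk
      rw [Finset.mem_range] at hk
      simp only [List.take_append_of_le_length (show k + 1 ≤ p.length by omega),
        List.take_append_of_le_length (show k ≤ u.length by omega),
        List.drop_append_of_le_length (show k + 1 ≤ p.length by omega),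
        List.drop_append_of_le_length (show k + 1 ≤ u.length by omega),
        List.getD_append _ _ _ _ hk]
      rw [interWord_insert_one _ _ _ _ _ _ (by simp; omega) hs']
    have hget (w : List A) (k : ℕ) : (u ++ w).getD (u.length + k) 1 = w.getD k 1 := by
      rw [List.getD_append_right _ _ _ _ (by omega), Nat.add_sub_cancel_left]
    have hmid : bt (p ++ [1]) (u ++ [f]) = 0 :=
      hbt.append_one hΦid hΦbimod p (u ++ [f]) (by simpa using hp)
        (by rintro rfl; simp at hp) (by
          simp only [List.mem_append, List.mem_singleton]
          rintro h (h' | rfl)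
          exacts [hu _ h', hf])
    have hmul : Φ (interWord (1 :: s) (g :: v)) = g * Φ (interWord s v) := by
      rw [interWord_cons_cons _ _ _ _ hs']
      simpa using hΦbimod g hg 1 B.one_mem (interWord s v)
    have hhigh : ∀ j ∈ Finset.range v.length,
        bt ((p ++ 1 :: s).take (u.length + (j + 1 + 1) + 1))
            ((u ++ f :: g :: v).take (u.length + (j + 1 + 1))) *
            (u ++ f :: g :: v).getD (u.length + (j + 1 + 1)) 1 *
            Φ (interWord ((p ++ 1 :: s).drop (u.length + (j + 1 + 1) + 1))
              ((u ++ f :: g :: v).drop (u.length + (j + 1 + 1) + 1))) =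
          bt ((p ++ s).take (u.length + (j + 1) + 1))
            ((u ++ f * g :: v).take (u.length + (j + 1))) *
            (u ++ f * g :: v).getD (u.length + (j + 1)) 1 *
            Φ (interWord ((p ++ s).drop (u.length + (j + 1) + 1))
              ((u ++ f * g :: v).drop (u.length + (j + 1) + 1))) := by
      intro j hj
      rw [Finset.mem_range] at hj
      rw [show u.length + (j + 1 + 1) + 1 = p.length + (j + 1 + 1) by omega,
        show u.length + (j + 1) + 1 = p.length + (j + 1) by omega]
      simp only [List.take_length_add_append, List.drop_length_add_append,
        List.take_succ_cons, List.drop_succ_cons]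
      rw [ih j hj (s.take (j + 1)) (v.take j) (by simp; omega)
        (fun h hh => hv h (List.mem_of_mem_take hh)) (by simp; omega)]
      rw [show p.length + (j + 1 + 1) = u.length + (j + 1 + 1 + 1) by omega,
        show p.length + (j + 1) = u.length + (j + 1 + 1) by omega]
      simp only [List.drop_length_add_append, List.drop_succ_cons, hget,
        List.getD_cons_succ]
    have e1 : (u ++ f :: g :: v).length = u.length + (v.length + 1 + 1) := by simp
    have e2 : (u ++ f * g :: v).length = u.length + (v.length + 1) := by simp
    rw [e2, Finset.sum_range_add _ u.length (v.length + 1), e1,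
      Finset.sum_range_add _ u.length (v.length + 1 + 1), Finset.sum_congr rfl hlow,
      Finset.sum_range_succ', Finset.sum_range_succ', Finset.sum_range_succ',
      Finset.sum_congr rfl hhigh] at key
    have t0 : (p ++ 1 :: s).take (u.length + 1) = p := by rw [← hp]; simp
    have t1 : (p ++ s).take (u.length + 1) = p := by rw [← hp]; simp
    have t2 : (p ++ 1 :: s).take (u.length + 1 + 1) = p ++ [1] := by
      rw [← hp, List.take_length_add_append]; simp
    have t3 : (u ++ f :: g :: v).take (u.length + 1) = u ++ [f] := by
      rw [List.take_length_add_append]; simp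
    have d0 : (p ++ 1 :: s).drop (u.length + 1) = 1 :: s := by rw [← hp]; simp
    have d1 : (p ++ s).drop (u.length + 1) = s := by rw [← hp]; simp
    have d2 : (u ++ f :: g :: v).drop (u.length + 1) = g :: v := by
      rw [List.drop_length_add_append]; simp
    have d3 : (u ++ f * g :: v).drop (u.length + 1) = v := by
      rw [List.drop_length_add_append]; simp
    simp only [zero_add, add_zero, t0, t1, t2, t3, d0, d1, d2, d3, hmid, hmul, zero_mul] at key
    simpa [mul_assoc] using key.symm

end IsOpBooleanCumulant

/-- Sums over compositions of `n + 2` split according to whether the first block is a singleton. -/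
theorem Composition.sum_blocks_succ {M : Type*} [AddCommMonoid M] (n : ℕ) (h : List ℕ → M) :
    ∑ c : Composition (n + 2), h c.blocks =
      ∑ c : Composition (n + 1), h (1 :: c.blocks) +
        ∑ c : Composition (n + 1), h (c.blocks.modifyHead (· + 1)) := by
  let φ : Composition (n + 1) ⊕ Composition (n + 1) → Composition (n + 2) := Sum.elim
    (fun c => ⟨1 :: c.blocks, by
      simp only [List.mem_cons]
      rintro i (rfl | hi)
      exacts [one_pos, c.blocks_pos hi], by simp [c.blocks_sum]; omega⟩)
    (fun c => ⟨c.blocks.modifyHead (· + 1), by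
      obtain ⟨_ | ⟨a, l⟩, h1, h2⟩ := c
      · simp
      · intro i hi
        simp only [List.modifyHead_cons, List.mem_cons] at hi
        rcases hi with rfl | hi
        exacts [Nat.succ_pos _, h1 (by simp [hi])], by
      obtain ⟨_ | ⟨a, l⟩, h1, h2⟩ := c
      · simp at h2
      · simp at h2 ⊢; omega⟩)
  have hφ : Function.Bijective φ := by
    constructor
    · rintro (⟨_ | ⟨a, l⟩, h1, h2⟩ | ⟨_ | ⟨a, l⟩, h1, h2⟩)
        (⟨_ | ⟨b, m⟩, h3, h4⟩ | ⟨_ | ⟨b, m⟩, h3, h4⟩) he <;>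
        simp [φ] at h2 h4 he ⊢
      · exact Composition.ext (by simp [he])
      · exact absurd he.1 (by have := h3 (i := b) (by simp); omega)
      · exact absurd he.1 (by have := h1 (i := a) (by simp); omega)
      · exact Composition.ext (by simp [he])
    · rintro ⟨_ | ⟨a, l⟩, h1, h2⟩
      · simp at h2
      · have ha : 0 < a := h1 (by simp)
        simp only [List.sum_cons] at h2
        obtain ⟨a, rfl⟩ := Nat.exists_eq_succ_of_ne_zero ha.ne'
        obtain rfl | ha' := Nat.eq_zero_or_pos a
        · exact ⟨Sum.inl ⟨l, fun hi => h1 (by simp [hi]), by omega⟩, rfl⟩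
        · refine ⟨Sum.inr ⟨a :: l, ?_, by simp; omega⟩, rfl⟩
          intro i hi
          rcases List.mem_cons.1 hi with rfl | hi
          exacts [ha', h1 (by simp [hi])]
  rw [← Fintype.sum_bijective φ hφ (fun c => h (φ c).blocks) _ (fun _ => rfl), Fintype.sum_sum_type]
  rfl

theorem IsOpBooleanCumulant.interior_one_add {A : Type*} [Ring A] [Algebra ℂ A]
    {B : Subalgebra ℂ A} {Φ : A →ₗ[ℂ] A} {bt : List A → List A → A}
    (hbt : IsOpBooleanCumulant B Φ bt) (hΦid : ∀ b ∈ B, Φ b = b)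
    (hΦbimod : ∀ b₁ ∈ B, ∀ b₂ ∈ B, ∀ a, Φ (b₁ * a * b₂) = b₁ * Φ a * b₂)
    (X g : A) (pre rest : List A) (hpre : ∀ f ∈ pre, f ∈ B) (hg : g ∈ B)
    (hrest : ∀ f ∈ rest, f ∈ B) :
    bt (List.replicate (pre.length + 1) X ++ (List.replicate rest.length (1 + X) ++ [X]))
        (pre ++ g :: rest) =
      ∑ c : Composition (rest.length + 1),
        bt (List.replicate (pre.length + c.blocks.length + 1) X)
          (pre ++ ((g :: rest).splitWrtCompositionAux c.blocks).map List.prod) := by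
  induction rest generalizing pre g with
  | nil =>
    have hc : (Finset.univ : Finset (Composition 1)) = {Composition.ones 1} :=
      (Finset.eq_of_subset_of_card_le (Finset.subset_univ _) (by simp [composition_card])).symm
    simp only [List.length_nil]
    rw [hc, Finset.sum_singleton]
    simp [Composition.ones, List.splitWrtCompositionAux, List.replicate_succ']
  | cons f rest ih =>
    have hf : f ∈ B := hrest f (by simp)
    have hrest' : ∀ h ∈ rest, h ∈ B := fun h hh => hrest h (by simp [hh])
    rw [List.length_cons, List.replicate_succ (n := rest.length), List.cons_append,
      hbt.add_entry _ _ _ _ _ (by simp; omega) (by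
        simp only [List.mem_append, List.mem_cons]
        rintro h (h' | rfl | rfl | h')
        exacts [hpre _ h', hg, hf, hrest' _ h']),
      hbt.insert_one hΦid hΦbimod g f _ _ _ _ (by simp) (by simp) hpre hg hf hrest',
      ih (g * f) pre hpre (B.mul_mem hg hf) hrest']
    have hstep := ih f (pre ++ [g]) (by
      simp only [List.mem_append, List.mem_singleton]
      rintro h (h' | rfl)
      exacts [hpre _ h', hg]) hf hrest'
    have hshift : List.replicate (pre.length + 1) X ++
        X :: (List.replicate rest.length (1 + X) ++ [X]) =
        List.replicate ((pre ++ [g]).length + 1) X ++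
          (List.replicate rest.length (1 + X) ++ [X]) := by
      rw [List.length_append, List.length_singleton, List.replicate_succ' (n := pre.length + 1)]
      simp
    rw [hshift, show pre ++ g :: f :: rest = (pre ++ [g]) ++ f :: rest by simp, hstep,
      Composition.sum_blocks_succ rest.length (fun l =>
        bt (List.replicate (pre.length + l.length + 1) X)
          (pre ++ ((g :: f :: rest).splitWrtCompositionAux l).map List.prod)), add_comm]
    congr 1
    · refine Finset.sum_congr rfl fun c _ => ?_
      simp [List.splitWrtCompositionAux, add_comm, add_left_comm]
    · refine Finset.sum_congr rfl fun c _ => ?_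
      obtain ⟨_ | ⟨a, l⟩, h1, h2⟩ := c
      · simp at h2
      · obtain ⟨a, rfl⟩ := Nat.exists_eq_succ_of_ne_zero (h1 (i := a) (by simp)).ne'
        simp [List.splitWrtCompositionAux, mul_assoc]

/-- Proposition 4.5: for `X ∈ 𝔄` and `n ≥ 2` (i.e. `fs = (f₁,…,f_{n-1})` nonempty),
`b̃^n_{1+X}(f₁,…,f_{n-1}) = ∑_{γ ∈ 𝓘(n-1)} b̃^{|γ|+1}_X(π_γ(f₁,…,f_{n-1}))`,
where the sum runs over interval partitions of `{1,…,n-1}` (encoded as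
`Composition fs.length`) and `π_γ` multiplies together the upper arguments indexed
by each block of `γ`. -/
theorem op_boolean_cumulant_one_plus_X
    {A : Type*} [Ring A] [Algebra ℂ A] (B : Subalgebra ℂ A)
    (Φ : A →ₗ[ℂ] A) (hΦmem : ∀ a, Φ a ∈ B) (hΦid : ∀ b ∈ B, Φ b = b)
    (hΦbimod : ∀ b₁ ∈ B, ∀ b₂ ∈ B, ∀ a, Φ (b₁ * a * b₂) = b₁ * Φ a * b₂)
    (bt : List A → List A → A) (hbt : IsOpBooleanCumulant B Φ bt)
    (X : A) (fs : List A) (hne : fs ≠ []) (hfs : ∀ f ∈ fs, f ∈ B) :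
    bt (List.replicate (fs.length + 1) (1 + X)) fs =
      ∑ c : Composition fs.length,
        bt (List.replicate (c.length + 1) X)
          ((fs.splitWrtComposition c).map List.prod) := by
  obtain _ | ⟨f, rest⟩ := fs
  · exact absurd rfl hne
  have hinterior := hbt.interior_one_add hΦid hΦbimod X f [] rest (by simp)
    (hfs f (by simp)) (fun h hh => hfs h (by simp [hh]))
  have hsplit : List.replicate ((f :: rest).length + 1) (1 + X) =
      (1 + X) :: (List.replicate rest.length (1 + X) ++ [1 + X]) := by
    rw [List.length_cons, List.replicate_succ, List.replicate_succ']
  have hfirst := hbt.add_entry 1 X [] (List.replicate rest.length (1 + X) ++ [1 + X])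
    (f :: rest) (by simp) hfs
  have hlast := hbt.add_entry 1 X (X :: List.replicate rest.length (1 + X)) []
    (f :: rest) (by simp) hfs
  rw [hbt.append_one hΦid hΦbimod _ _ (by simp) (by simp) hfs, zero_add] at hlast
  simp only [List.nil_append, List.cons_append] at hfirst hlast
  rw [hbt.one_cons hΦid hΦbimod _ _ (by simp) (by simp) hfs, zero_add] at hfirst
  rw [hsplit, hfirst, hlast]
  simpa [Composition.length, List.splitWrtComposition] using hinterior
end
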